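/- arXiv:1211.3106 — 2 statements merged into one kernel-verified Lean document; each statement's English description precedes it below -/
import Mathlib

section
/- Let p_0, p_1, p_2 ≥ 0 with p_0 + p_1 + p_2 = 1. The following are equivalent: (I) (p_0, p_1, p_2) ∈ Δ_TF(K̄_3, P̄_3, P_3); (II) the 2×2 matrix p_0·[[1,0],[0,0]] + p_1·[[1/3,1/3],[1/3,0]] + p_2·[[0,1/3],[1/3,1/3]] is positive semidefinite; (III) (p_0, p_1, p_2) ∈ Δ_BP(K̄_3, P̄_3, P_3). -/
open Finset

open scoped Classical

/-- The induced density `d(H;G)`: the probability that a uniformly random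
`|V(H)|`-element subset of `V(G)` induces a subgraph isomorphic to `H`. -/
noncomputable def inducedDensity {W V : Type*} [Fintype W] [Fintype V] [DecidableEq V]
    (H : SimpleGraph W) (G : SimpleGraph V) : ℝ :=
  (((univ : Finset V).powersetCard (Fintype.card W)).filter
      (fun S => Nonempty (H ≃g G.induce (S : Set V)))).card /
    ((univ : Finset V).powersetCard (Fintype.card W)).card

/-- The number of edges of `G` spanned by the vertex set `S`. -/
noncomputable def edgesIn {V : Type*} [Fintype V] [DecidableEq V]
    (G : SimpleGraph V) (S : Finset V) : ℕ :=
  ((S.powersetCard 2).filter (fun T => ∀ x ∈ T, ∀ y ∈ T, x ≠ y → G.Adj x y)).card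

/-- `localProfile G i = p_i(G)`: the probability that a uniformly random 3-element
subset of `V(G)` spans exactly `i` edges. -/
noncomputable def localProfile {V : Type*} [Fintype V] [DecidableEq V]
    (G : SimpleGraph V) (i : ℕ) : ℝ :=
  (((univ : Finset V).powersetCard 3).filter (fun S => edgesIn G S = i)).card /
    ((univ : Finset V).powersetCard 3).card

/-- A class of finite simple graphs, given by a set of graphs on `Fin n` for each `n`. -/
abbrev GraphClass : Type := ∀ n : ℕ, Set (SimpleGraph (Fin n))

/-- The class `𝒢` is closed under taking induced subgraphs (up to isomorphism). -/
def ClosedUnderInduced (𝒢 : GraphClass) : Prop :=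
  ∀ n : ℕ, ∀ G ∈ 𝒢 n, ∀ m : ℕ, ∀ G' : SimpleGraph (Fin m),
    (∃ S : Finset (Fin n), Nonempty (G' ≃g G.induce (S : Set (Fin n)))) → G' ∈ 𝒢 m

/-- The class `𝒢` is infinite: it contains graphs on arbitrarily many vertices. -/
def InfiniteClass (𝒢 : GraphClass) : Prop :=
  ∀ N : ℕ, ∃ n : ℕ, N ≤ n ∧ (𝒢 n).Nonempty

/-- Membership of `(p₁,…,p_t)` in `Δ_𝒢(H₁,…,H_t)`: there is a sequence of graphs
`G_j ∈ 𝒢` with `|V(G_j)| → ∞` and `d(Hᵢ;G_j) → pᵢ` for each `i`. -/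
def memDeltaClass (𝒢 : GraphClass) {t : ℕ} {ms : Fin t → ℕ}
    (H : ∀ i, SimpleGraph (Fin (ms i))) (p : Fin t → ℝ) : Prop :=
  ∃ (m : ℕ → ℕ) (Gs : ∀ j, SimpleGraph (Fin (m j))),
    (∀ j, Gs j ∈ 𝒢 (m j)) ∧
    Filter.Tendsto m Filter.atTop Filter.atTop ∧
    ∀ i, Filter.Tendsto (fun j => inducedDensity (H i) (Gs j)) Filter.atTop (nhds (p i))

/-- The path `P₃` on three vertices (edges `01` and `12`). -/
def path3 : SimpleGraph (Fin 3) :=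
  SimpleGraph.fromRel (fun x y => (x = 0 ∧ y = 1) ∨ (x = 1 ∧ y = 2))

/-- The class of triangle-free graphs. -/
def triangleFreeClass : GraphClass := fun n => {G : SimpleGraph (Fin n) | G.CliqueFree 3}

/-- The class of bipartite graphs. -/
def bipartiteClass : GraphClass := fun n => {G : SimpleGraph (Fin n) | G.Colorable 2}

/-- The matrix `p₀·[[1,0],[0,0]] + p₁·[[1/3,1/3],[1/3,0]] + p₂·[[0,1/3],[1/3,1/3]]`. -/
noncomputable def profileMatrix (p₀ p₁ p₂ : ℝ) : Matrix (Fin 2) (Fin 2) ℝ :=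
  p₀ • !![(1 : ℝ), 0; 0, 0] + p₁ • !![(1 : ℝ)/3, 1/3; 1/3, 0] +
    p₂ • !![(0 : ℝ), 1/3; 1/3, 1/3]

/-- ordered adjacent pairs inside `S` -/
noncomputable def cPair {V : Type*} [Fintype V] [DecidableEq V] (G : SimpleGraph V)
    (S : Finset V) : ℕ :=
  (univ.filter (fun t : V × V => (t.1 ∈ S ∧ t.2 ∈ S) ∧ G.Adj t.1 t.2)).card

/-- ordered cherries inside `S` -/
noncomputable def cCherry {V : Type*} [Fintype V] [DecidableEq V] (G : SimpleGraph V)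
    (S : Finset V) : ℕ :=
  (univ.filter (fun t : V × V × V => (t.1 ∈ S ∧ t.2.1 ∈ S ∧ t.2.2 ∈ S) ∧
    (G.Adj t.1 t.2.1 ∧ G.Adj t.1 t.2.2 ∧ t.2.1 ≠ t.2.2))).card

lemma cPair_iso {V : Type*} [Fintype V] [DecidableEq V] (G : SimpleGraph V) (S : Finset V)
    (H : SimpleGraph (Fin 3)) (e : H ≃g G.induce (S : Set V)) :
    cPair G S = (univ.filter (fun t : Fin 3 × Fin 3 => H.Adj t.1 t.2)).card := by
  symm
  unfold cPair
  refine Finset.card_bij (fun t _ => ((e t.1 : V), (e t.2 : V))) ?_ ?_ ?_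
  · intro t ht
    simp only [mem_filter, mem_univ, true_and] at ht ⊢
    refine ⟨⟨(e t.1).2, (e t.2).2⟩, ?_⟩
    exact (e.map_adj_iff.2 ht)
  · intro t _ t' _ h
    simp only [Prod.mk.injEq, Subtype.coe_inj, EmbeddingLike.apply_eq_iff_eq] at h
    exact Prod.ext h.1 h.2
  · rintro ⟨x, y⟩ h
    simp only [mem_filter, mem_univ, true_and] at h
    obtain ⟨⟨hx, hy⟩, hxy⟩ := h
    obtain ⟨i, hi⟩ := e.surjective ⟨x, hx⟩
    obtain ⟨j, hj⟩ := e.surjective ⟨y, hy⟩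
    refine ⟨(i, j), ?_, by simp [hi, hj]⟩
    simp only [mem_filter, mem_univ, true_and]
    rw [← e.map_adj_iff, hi, hj]
    exact hxy

lemma cCherry_iso {V : Type*} [Fintype V] [DecidableEq V] (G : SimpleGraph V) (S : Finset V)
    (H : SimpleGraph (Fin 3)) (e : H ≃g G.induce (S : Set V)) :
    cCherry G S = (univ.filter (fun t : Fin 3 × Fin 3 × Fin 3 =>
      H.Adj t.1 t.2.1 ∧ H.Adj t.1 t.2.2 ∧ t.2.1 ≠ t.2.2)).card := by
  symm
  unfold cCherry
  refine Finset.card_bij (fun t _ => ((e t.1 : V), (e t.2.1 : V), (e t.2.2 : V))) ?_ ?_ ?_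
  · intro t ht
    simp only [mem_filter, mem_univ, true_and] at ht ⊢
    refine ⟨⟨(e t.1).2, (e t.2.1).2, (e t.2.2).2⟩, ?_, ?_, ?_⟩
    · exact (e.map_adj_iff.2 ht.1)
    · exact (e.map_adj_iff.2 ht.2.1)
    · intro h
      exact ht.2.2 (e.injective (Subtype.ext h))
  · intro t _ t' _ h
    simp only [Prod.mk.injEq, Subtype.coe_inj, EmbeddingLike.apply_eq_iff_eq] at h
    exact Prod.ext h.1 (Prod.ext h.2.1 h.2.2)
  · rintro ⟨x, y, z⟩ h
    simp only [mem_filter, mem_univ, true_and] at h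
    obtain ⟨⟨hx, hy, hz⟩, hxy, hxz, hyz⟩ := h
    obtain ⟨i, hi⟩ := e.surjective ⟨x, hx⟩
    obtain ⟨j, hj⟩ := e.surjective ⟨y, hy⟩
    obtain ⟨k, hk⟩ := e.surjective ⟨z, hz⟩
    refine ⟨(i, j, k), ?_, by simp [hi, hj, hk]⟩
    simp only [mem_filter, mem_univ, true_and]
    rw [← e.map_adj_iff, ← e.map_adj_iff, hi, hj, hk]
    refine ⟨hxy, hxz, ?_⟩
    rintro rfl
    rw [hj] at hk
    exact hyz (congrArg Subtype.val hk)

lemma path3_adj (i j : Fin 3) : path3.Adj i j ↔ (i.val + 1 = j.val ∨ j.val + 1 = i.val) := by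
  unfold path3
  rw [SimpleGraph.fromRel_adj]
  revert i j
  decide

lemma path3c_adj (i j : Fin 3) : path3ᶜ.Adj i j ↔ (i.val + 2 = j.val ∨ j.val + 2 = i.val) := by
  rw [SimpleGraph.compl_adj, path3_adj]
  revert i j
  decide

lemma count_vals :
    ((univ.filter (fun t : Fin 3 × Fin 3 => (⊥ : SimpleGraph (Fin 3)).Adj t.1 t.2)).card = 0 ∧
    (univ.filter (fun t : Fin 3 × Fin 3 => path3ᶜ.Adj t.1 t.2)).card = 2 ∧
    (univ.filter (fun t : Fin 3 × Fin 3 => path3.Adj t.1 t.2)).card = 4) ∧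
    ((univ.filter (fun t : Fin 3 × Fin 3 × Fin 3 =>
      (⊥ : SimpleGraph (Fin 3)).Adj t.1 t.2.1 ∧ (⊥ : SimpleGraph (Fin 3)).Adj t.1 t.2.2 ∧
        t.2.1 ≠ t.2.2)).card = 0 ∧
    (univ.filter (fun t : Fin 3 × Fin 3 × Fin 3 =>
      path3ᶜ.Adj t.1 t.2.1 ∧ path3ᶜ.Adj t.1 t.2.2 ∧ t.2.1 ≠ t.2.2)).card = 0 ∧
    (univ.filter (fun t : Fin 3 × Fin 3 × Fin 3 =>
      path3.Adj t.1 t.2.1 ∧ path3.Adj t.1 t.2.2 ∧ t.2.1 ≠ t.2.2)).card = 2) := by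
  simp only [path3_adj, path3c_adj, SimpleGraph.bot_adj]
  refine ⟨⟨?_, ?_, ?_⟩, ?_, ?_, ?_⟩
  · simp
  · convert_to (univ.filter (fun t : Fin 3 × Fin 3 =>
      (t.1.val + 2 = t.2.val ∨ t.2.val + 2 = t.1.val))).card = 2
    decide
  · convert_to (univ.filter (fun t : Fin 3 × Fin 3 =>
      (t.1.val + 1 = t.2.val ∨ t.2.val + 1 = t.1.val))).card = 4
    decide
  · simp
  · rw [Finset.card_eq_zero, Finset.filter_eq_empty_iff]
    decide
  · have : (univ.filter (fun t : Fin 3 × Fin 3 × Fin 3 =>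
      (t.1.val + 1 = t.2.1.val ∨ t.2.1.val + 1 = t.1.val) ∧
      (t.1.val + 1 = t.2.2.val ∨ t.2.2.val + 1 = t.1.val) ∧ t.2.1 ≠ t.2.2)) =
      {((1 : Fin 3), (0 : Fin 3), (2 : Fin 3)), (1, 2, 0)} := by
      ext t
      simp only [mem_filter, mem_univ, true_and, mem_insert, mem_singleton]
      revert t
      decide
    rw [this]
    decide

lemma iso_of {V : Type*} (G : SimpleGraph V) (H : SimpleGraph (Fin 3)) (S : Finset V)
    (a b c : V) (hab : a ≠ b) (hac : a ≠ c) (hbc : b ≠ c)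
    (hS : ∀ x, x ∈ S ↔ x = a ∨ x = b ∨ x = c)
    (h1 : G.Adj a b ↔ H.Adj 0 1) (h2 : G.Adj a c ↔ H.Adj 0 2) (h3 : G.Adj b c ↔ H.Adj 1 2) :
    Nonempty (H ≃g G.induce (S : Set V)) := by
  have hmem : ∀ i : Fin 3, (![a, b, c] i) ∈ (S : Set V) := by
    intro i
    fin_cases i <;> simp [hS]
  let f : Fin 3 → (S : Set V) := fun i => ⟨![a, b, c] i, hmem i⟩
  have hf : Function.Bijective f := by
    constructor
    · intro i j hij
      have h := congrArg Subtype.val hij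
      simp only [f] at h
      fin_cases i <;> fin_cases j <;> simp_all
    · rintro ⟨x, hx⟩
      rcases (hS x).1 hx with rfl | rfl | rfl
      · exact ⟨0, rfl⟩
      · exact ⟨1, rfl⟩
      · exact ⟨2, rfl⟩
  refine ⟨⟨Equiv.ofBijective f hf, ?_⟩⟩
  intro i j
  change G.Adj (![a, b, c] i) (![a, b, c] j) ↔ H.Adj i j
  fin_cases i <;> fin_cases j <;> simp [h1, h2, h3, G.adj_comm b a, G.adj_comm c a,
    G.adj_comm c b, H.adj_comm 1 0, H.adj_comm 2 0, H.adj_comm 2 1]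

set_option linter.unusedSimpArgs false in
lemma iso_exists {V : Type*} [DecidableEq V] (G : SimpleGraph V) (hG : G.CliqueFree 3)
    (S : Finset V) (hS : S.card = 3) :
    Nonempty ((⊥ : SimpleGraph (Fin 3)) ≃g G.induce (S : Set V)) ∨
    Nonempty (path3ᶜ ≃g G.induce (S : Set V)) ∨ Nonempty (path3 ≃g G.induce (S : Set V)) := by
  obtain ⟨a, b, c, hab, hac, hbc, rfl⟩ := Finset.card_eq_three.1 hS
  have hn : ¬ (G.Adj a b ∧ G.Adj a c ∧ G.Adj b c) := by
    intro h
    exact hG {a, b, c} (SimpleGraph.is3Clique_triple_iff.2 h)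
  have p01 : path3.Adj 0 1 := by rw [path3_adj]; decide
  have p12 : path3.Adj 1 2 := by rw [path3_adj]; decide
  have p02 : ¬ path3.Adj 0 2 := by rw [path3_adj]; decide
  have q01 : ¬ path3ᶜ.Adj 0 1 := by rw [path3c_adj]; decide
  have q12 : ¬ path3ᶜ.Adj 1 2 := by rw [path3c_adj]; decide
  have q02 : path3ᶜ.Adj 0 2 := by rw [path3c_adj]; decide
  have key := fun H : SimpleGraph (Fin 3) => iso_of G H ({a, b, c} : Finset V)
  have sba := G.adj_comm b a
  have sca := G.adj_comm c a
  have scb := G.adj_comm c b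
  by_cases h1 : G.Adj a b <;> by_cases h2 : G.Adj a c <;> by_cases h3 : G.Adj b c
  · exact absurd ⟨h1, h2, h3⟩ hn
  · right; right
    exact key _ b a c hab.symm hbc hac (by intro x; simp [or_comm, or_left_comm]) (by simp only [sba, sca, scb, h1, h2, h3, p01, p12, p02, q01, q12, q02]) (by simp only [sba, sca, scb, h1, h2, h3, p01, p12, p02, q01, q12, q02]) (by simp only [sba, sca, scb, h1, h2, h3, p01, p12, p02, q01, q12, q02])
  · right; right
    exact key _ a b c hab hac hbc (by intro x; simp) (by simp only [sba, sca, scb, h1, h2, h3, p01, p12, p02, q01, q12, q02]) (by simp only [sba, sca, scb, h1, h2, h3, p01, p12, p02, q01, q12, q02]) (by simp only [sba, sca, scb, h1, h2, h3, p01, p12, p02, q01, q12, q02])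
  · right; left
    exact key _ a c b hac hab hbc.symm (by intro x; simp [or_comm, or_left_comm]) (by simp only [sba, sca, scb, h1, h2, h3, p01, p12, p02, q01, q12, q02]) (by simp only [sba, sca, scb, h1, h2, h3, p01, p12, p02, q01, q12, q02]) (by simp only [sba, sca, scb, h1, h2, h3, p01, p12, p02, q01, q12, q02])
  · right; right
    exact key _ a c b hac hab hbc.symm (by intro x; simp [or_comm, or_left_comm]) (by simp only [sba, sca, scb, h1, h2, h3, p01, p12, p02, q01, q12, q02]) (by simp only [sba, sca, scb, h1, h2, h3, p01, p12, p02, q01, q12, q02]) (by simp only [sba, sca, scb, h1, h2, h3, p01, p12, p02, q01, q12, q02])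
  · right; left
    exact key _ a b c hab hac hbc (by intro x; simp) (by simp only [sba, sca, scb, h1, h2, h3, p01, p12, p02, q01, q12, q02]) (by simp only [sba, sca, scb, h1, h2, h3, p01, p12, p02, q01, q12, q02]) (by simp only [sba, sca, scb, h1, h2, h3, p01, p12, p02, q01, q12, q02])
  · right; left
    exact key _ b a c hab.symm hbc hac (by intro x; simp [or_comm, or_left_comm]) (by simp only [sba, sca, scb, h1, h2, h3, p01, p12, p02, q01, q12, q02]) (by simp only [sba, sca, scb, h1, h2, h3, p01, p12, p02, q01, q12, q02]) (by simp only [sba, sca, scb, h1, h2, h3, p01, p12, p02, q01, q12, q02])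
  · left
    exact key _ a b c hab hac hbc (by intro x; simp) (by simpa) (by simpa) (by simpa)

lemma sum_cPair {V : Type*} [Fintype V] [DecidableEq V] (G : SimpleGraph V) :
    ∑ S ∈ (univ : Finset V).powersetCard 3, cPair G S
      = (Fintype.card V - 2) * ∑ v, G.degree v := by
  have hdeg : ∑ v, G.degree v = (univ.filter (fun t : V × V => G.Adj t.1 t.2)).card := by
    rw [Finset.card_filter, Fintype.sum_prod_type]
    refine Finset.sum_congr rfl fun v _ => ?_
    rw [← G.card_neighborFinset_eq_degree, SimpleGraph.neighborFinset_eq_filter,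
      Finset.card_filter]
  rw [hdeg]
  unfold cPair
  simp_rw [Finset.card_filter]
  rw [Finset.sum_comm, Finset.mul_sum]
  refine Finset.sum_congr rfl ?_
  rintro ⟨x, y⟩ _
  by_cases hxy : G.Adj x y
  · simp only [hxy, and_true, if_true, mul_one]
    rw [← Finset.card_filter]
    have hne := hxy.ne
    have : ((univ : Finset V).powersetCard 3).filter (fun S => x ∈ S ∧ y ∈ S)
        = (univ \ {x, y} : Finset V).image (fun z => {x, y, z}) := by
      ext S
      simp only [mem_filter, mem_powersetCard, subset_univ, true_and, mem_image, mem_sdiff,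
        mem_univ, mem_insert, mem_singleton, not_or]
      constructor
      · rintro ⟨hS, hx, hy⟩
        have hc : (S \ {x, y}).card = 1 := by
          rw [Finset.card_sdiff_of_subset (by intro z; simp; rintro (rfl | rfl) <;> assumption),
            hS, Finset.card_pair hne]
        obtain ⟨z, hz⟩ := Finset.card_eq_one.1 hc
        have hz' : ∀ w, (w ∈ S ∧ ¬ (w = x ∨ w = y)) ↔ w = z := by
          intro w
          have := Finset.ext_iff.1 hz w
          simpa using this
        refine ⟨z, by have := (hz' z).2 rfl; tauto, ?_⟩
        ext w
        have := hz' w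
        simp only [mem_insert, mem_singleton]
        by_cases h1 : w = x
        · subst h1; tauto
        · by_cases h2 : w = y
          · subst h2; tauto
          · tauto
      · rintro ⟨z, ⟨h1, h2⟩, rfl⟩
        refine ⟨Finset.card_eq_three.2 ⟨x, y, z, hne, Ne.symm h1, Ne.symm h2, rfl⟩, by simp,
          by simp⟩
    rw [this, Finset.card_image_of_injOn, Finset.card_sdiff_of_subset (subset_univ _),
      Finset.card_pair hne, Finset.card_univ]
    intro z hz z' hz' h
    simp only [coe_sdiff, coe_univ, coe_insert, coe_singleton, Set.mem_sdiff, Set.mem_univ,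
      Set.mem_insert_iff, Set.mem_singleton_iff, true_and, not_or] at hz hz'
    have := (Finset.ext_iff.1 h z).1 (by simp)
    simp only [mem_insert, mem_singleton] at this
    tauto
  · simp [hxy]

lemma sum_cCherry {V : Type*} [Fintype V] [DecidableEq V] (G : SimpleGraph V) :
    (∑ S ∈ (univ : Finset V).powersetCard 3, cCherry G S) + ∑ v, G.degree v
      = ∑ v, G.degree v ^ 2 := by
  have h1 : ∑ S ∈ (univ : Finset V).powersetCard 3, cCherry G S =
      ∑ v, (G.neighborFinset v).offDiag.card := by
    have h2 : ∑ v, (G.neighborFinset v).offDiag.card = (univ.filter (fun t : V × V × V =>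
      (G.Adj t.1 t.2.1 ∧ G.Adj t.1 t.2.2 ∧ t.2.1 ≠ t.2.2))).card := by
      rw [Finset.card_filter, Fintype.sum_prod_type]
      refine Finset.sum_congr rfl fun v _ => ?_
      rw [← Finset.card_filter]
      congr 1
      ext t
      simp
    rw [h2]
    unfold cCherry
    simp_rw [Finset.card_filter]
    rw [Finset.sum_comm]
    refine Finset.sum_congr rfl ?_
    rintro ⟨x, y, z⟩ _
    by_cases h : (G.Adj x y ∧ G.Adj x z ∧ y ≠ z)
    · have hc : ({x, y, z} : Finset V).card = 3 :=
        Finset.card_eq_three.2 ⟨x, y, z, h.1.ne, h.2.1.ne, h.2.2, rfl⟩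
      simp only [h, and_true, if_true, ne_eq, not_false_eq_true]
      rw [← Finset.card_filter, Finset.card_eq_one]
      refine ⟨{x, y, z}, ?_⟩
      ext S
      simp only [mem_filter, mem_powersetCard, subset_univ, true_and, mem_singleton]
      constructor
      · rintro ⟨hS, hx, hy, hz⟩
        symm
        apply Finset.eq_of_subset_of_card_le
        · intro w
          simp only [mem_insert, mem_singleton]
          rintro (rfl | rfl | rfl) <;> assumption
        · omega
      · rintro rfl
        exact ⟨hc, by simp, by simp, by simp⟩
    · simp only [h, and_false, if_false, Finset.sum_const_zero]
  rw [h1, ← Finset.sum_add_distrib]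
  refine Finset.sum_congr rfl fun v _ => ?_
  rw [Finset.offDiag_card, G.card_neighborFinset_eq_degree, sq]
  exact Nat.sub_add_cancel (Nat.le_mul_self _)

/-- number of induced copies -/
noncomputable def nInd {V : Type*} [Fintype V] [DecidableEq V] (H : SimpleGraph (Fin 3))
    (G : SimpleGraph V) : ℕ :=
  (((univ : Finset V).powersetCard 3).filter
      (fun S : Finset V => Nonempty (H ≃g G.induce (S : Set V)))).card

lemma counts {V : Type*} [Fintype V] [DecidableEq V] (G : SimpleGraph V) (hG : G.CliqueFree 3) :
    nInd ⊥ G + nInd path3ᶜ G + nInd path3 G = (Fintype.card V).choose 3 ∧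
    2 * nInd path3ᶜ G + 4 * nInd path3 G = (Fintype.card V - 2) * ∑ v, G.degree v ∧
    2 * nInd path3 G + ∑ v, G.degree v = ∑ v, G.degree v ^ 2 := by
  obtain ⟨⟨a0, a1, a2⟩, b0, b1, b2⟩ := count_vals
  have key : ∀ S ∈ (univ : Finset V).powersetCard 3,
      ((if Nonempty ((⊥ : SimpleGraph (Fin 3)) ≃g G.induce (S : Set V)) then 1 else 0) +
       (if Nonempty (path3ᶜ ≃g G.induce (S : Set V)) then 1 else 0) +
       (if Nonempty (path3 ≃g G.induce (S : Set V)) then 1 else 0) = 1) ∧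
      (2 * (if Nonempty (path3ᶜ ≃g G.induce (S : Set V)) then 1 else 0) +
       4 * (if Nonempty (path3 ≃g G.induce (S : Set V)) then 1 else 0) = cPair G S) ∧
      2 * (if Nonempty (path3 ≃g G.induce (S : Set V)) then 1 else 0) = cCherry G S := by
    intro S hS
    have h0 : Nonempty ((⊥ : SimpleGraph (Fin 3)) ≃g G.induce (S : Set V)) →
        cPair G S = 0 ∧ cCherry G S = 0 := by
      rintro ⟨e⟩
      exact ⟨(cPair_iso G S _ e).trans (by convert a0), (cCherry_iso G S _ e).trans (by convert b0)⟩
    have h1 : Nonempty (path3ᶜ ≃g G.induce (S : Set V)) →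
        cPair G S = 2 ∧ cCherry G S = 0 := by
      rintro ⟨e⟩
      exact ⟨(cPair_iso G S _ e).trans (by convert a1), (cCherry_iso G S _ e).trans (by convert b1)⟩
    have h2 : Nonempty (path3 ≃g G.induce (S : Set V)) →
        cPair G S = 4 ∧ cCherry G S = 2 := by
      rintro ⟨e⟩
      exact ⟨(cPair_iso G S _ e).trans (by convert a2), (cCherry_iso G S _ e).trans (by convert b2)⟩
    have hex := iso_exists G hG S (mem_powersetCard.1 hS).2
    split_ifs with i0 i1 i2 i2 i1 i2 i2
    all_goals first | (have := h0 i0) | skip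
    all_goals first | (have := h1 i1) | skip
    all_goals first | (have := h2 i2) | skip
    all_goals first | omega | tauto
  refine ⟨?_, ?_, ?_⟩
  · unfold nInd
    simp_rw [Finset.card_filter]
    rw [← Finset.sum_add_distrib, ← Finset.sum_add_distrib,
      Finset.sum_congr rfl (fun S hS => (key S hS).1)]
    simp
  · rw [← sum_cPair, ← Finset.sum_congr rfl (fun S hS => (key S hS).2.1)]
    unfold nInd
    simp_rw [Finset.card_filter]
    rw [Finset.sum_add_distrib, Finset.mul_sum, Finset.mul_sum]
  · rw [← sum_cCherry, ← Finset.sum_congr rfl (fun S hS => (key S hS).2.2)]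
    unfold nInd
    simp_rw [Finset.card_filter]
    rw [Finset.mul_sum]

lemma inducedDensity_eq {n : ℕ} (H : SimpleGraph (Fin 3)) (G : SimpleGraph (Fin n)) :
    inducedDensity H G = (nInd H G : ℝ) / (n.choose 3 : ℕ) := by
  have hc : Fintype.card (Fin 3) = 3 := by simp
  unfold inducedDensity nInd
  rw [hc]
  congr 2
  · symm
    refine Finset.card_bij (fun (S : Finset (Fin n)) _ => (S : Set (Fin n))) ?_ ?_ ?_
    · intro S hS
      rw [mem_filter] at hS
      rw [mem_filter]
      exact ⟨Finset.mem_sup.2 ⟨S, hS.1, Finset.mem_singleton.2 rfl⟩, hS.2⟩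
    · intro S _ T _ h
      exact Finset.coe_injective h
    · intro A hA
      rw [mem_filter] at hA
      obtain ⟨hA0, hA2⟩ := hA
      obtain ⟨S, hS, hA1⟩ := Finset.mem_sup.1 hA0
      have hA3 : A = (S : Set (Fin n)) := Finset.mem_singleton.1 hA1
      subst hA3
      exact ⟨S, mem_filter.2 ⟨hS, hA2⟩, rfl⟩
  · simp

lemma choose3 (n : ℕ) (hn : 3 ≤ n) :
    ((n.choose 3 : ℕ) : ℝ) = (n : ℝ) * (n - 1) * (n - 2) / 6 := by
  rw [Nat.cast_choose_eq_descPochhammer_div]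
  have : (descPochhammer ℝ 3).eval (n : ℝ) = (n : ℝ) * (n - 1) * (n - 2) := by
    simp [descPochhammer_succ_right, descPochhammer_zero]
  rw [this]
  norm_num [Nat.factorial]

lemma densities {n : ℕ} (hn : 3 ≤ n) (G : SimpleGraph (Fin n)) (hG : G.CliqueFree 3) :
    inducedDensity (⊥ : SimpleGraph (Fin 3)) G + inducedDensity path3ᶜ G
      + inducedDensity path3 G = 1 ∧
    (inducedDensity path3ᶜ G + 2 * inducedDensity path3 G) * ((n : ℝ) * (n - 1))
      = 3 * ∑ v, (G.degree v : ℝ) ∧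
    inducedDensity path3 G * ((n : ℝ) * (n - 1) * (n - 2))
      = 3 * (∑ v, (G.degree v : ℝ) ^ 2 - ∑ v, (G.degree v : ℝ)) := by
  obtain ⟨h1, h2, h3⟩ := counts G hG
  simp only [Fintype.card_fin] at h1 h2 h3
  have hn' : (3 : ℝ) ≤ n := by exact_mod_cast hn
  have hc := choose3 n hn
  have hcpos : (0 : ℝ) < (n : ℝ) * (n - 1) * (n - 2) := by
    have : (0 : ℝ) < n - 1 := by linarith
    have : (0 : ℝ) < n - 2 := by linarith
    positivity
  have e1 : (nInd ⊥ G : ℝ) + nInd path3ᶜ G + nInd path3 G = (n.choose 3 : ℕ) := by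
    exact_mod_cast h1
  have e2 : 2 * (nInd path3ᶜ G : ℝ) + 4 * nInd path3 G = (n - 2) * ∑ v, (G.degree v : ℝ) := by
    have := congrArg (Nat.cast : ℕ → ℝ) h2
    push_cast [Nat.cast_sub (show 2 ≤ n by omega)] at this
    exact this
  have e3 : 2 * (nInd path3 G : ℝ) + ∑ v, (G.degree v : ℝ) = ∑ v, (G.degree v : ℝ) ^ 2 := by
    exact_mod_cast h3
  simp only [inducedDensity_eq]
  have hn2 : (n : ℝ) - 2 ≠ 0 := by linarith
  have hn1 : (n : ℝ) - 1 ≠ 0 := by linarith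
  have hn0 : (n : ℝ) ≠ 0 := by linarith
  refine ⟨?_, ?_, ?_⟩
  · rw [← add_div, ← add_div, e1]
    apply div_self
    rw [hc]; positivity
  · rw [hc]
    field_simp
    linarith
  · rw [hc]
    field_simp
    linarith

lemma psd_iff (p₀ p₁ p₂ : ℝ)
    (h₀ : 0 ≤ p₀) (h₁ : 0 ≤ p₁) (h₂ : 0 ≤ p₂) (hsum : p₀ + p₁ + p₂ = 1) :
    (profileMatrix p₀ p₁ p₂).PosSemidef ↔ (p₁ + 2 * p₂) ^ 2 ≤ 3 * p₂ := by
  constructor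
  · intro h
    have := h.det_nonneg
    simp [profileMatrix, Matrix.det_fin_two] at this
    nlinarith
  · intro h
    refine Matrix.PosSemidef.of_dotProduct_mulVec_nonneg ?_ ?_
    · ext i j
      fin_cases i <;> fin_cases j <;> simp [profileMatrix]
    · intro x
      have e : star x ⬝ᵥ (profileMatrix p₀ p₁ p₂).mulVec x =
        (p₀ + p₁ / 3) * x 0 ^ 2 + 2 * ((p₁ + p₂) / 3) * (x 0 * x 1) + p₂ / 3 * x 1 ^ 2 := by
        simp [profileMatrix, Matrix.mulVec, dotProduct, Fin.sum_univ_two]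
        ring
      rw [e]
      rcases h₂.eq_or_lt with h' | h'
      · subst h'
        have : p₁ = 0 := by nlinarith
        subst this
        have : 0 ≤ p₀ * x 0 ^ 2 := by positivity
        linarith
      · have hd : 0 ≤ (p₀ + p₁ / 3) * (p₂ / 3) - ((p₁ + p₂) / 3) ^ 2 := by
          have : p₀ = 1 - p₁ - p₂ := by linarith
          subst this
          nlinarith
        refine nonneg_of_mul_nonneg_right (a := p₂ / 3) ?_ (by positivity)
        have := mul_nonneg hd (sq_nonneg (x 0))
        nlinarith [sq_nonneg ((p₁ + p₂) / 3 * x 0 + p₂ / 3 * x 1)]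

lemma tf_to_ineq (p₀ p₁ p₂ : ℝ)
    (h : memDeltaClass triangleFreeClass (ms := fun _ => 3)
        ![(⊥ : SimpleGraph (Fin 3)), path3ᶜ, path3] ![p₀, p₁, p₂]) :
    (p₁ + 2 * p₂) ^ 2 ≤ 3 * p₂ := by
  obtain ⟨m, Gs, hG, hm, hlim⟩ := h
  have l1 : Filter.Tendsto (fun j => inducedDensity path3ᶜ (Gs j)) Filter.atTop (nhds p₁) := hlim 1
  have l2 : Filter.Tendsto (fun j => inducedDensity path3 (Gs j)) Filter.atTop (nhds p₂) := hlim 2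
  have hmR : Filter.Tendsto (fun j => (m j : ℝ)) Filter.atTop Filter.atTop :=
    tendsto_natCast_atTop_atTop.comp hm
  have hm1 : Filter.Tendsto (fun j => (6 : ℝ) / ((m j : ℝ) - 1)) Filter.atTop (nhds 0) :=
    Filter.Tendsto.const_div_atTop (Filter.tendsto_atTop_add_const_right _ (-1) hmR) 6
  have L : Filter.Tendsto (fun j => (inducedDensity path3ᶜ (Gs j)
      + 2 * inducedDensity path3 (Gs j)) ^ 2) Filter.atTop (nhds ((p₁ + 2 * p₂) ^ 2)) :=
    (l1.add (l2.const_mul 2)).pow 2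
  have R : Filter.Tendsto (fun j => 3 * inducedDensity path3 (Gs j) + 6 / ((m j : ℝ) - 1))
      Filter.atTop (nhds (3 * p₂ + 0)) := (l2.const_mul 3).add hm1
  rw [add_zero] at R
  refine le_of_tendsto_of_tendsto L R ?_
  filter_upwards [hm.eventually_ge_atTop 3] with j hj
  obtain ⟨d0, d1, d2⟩ := densities hj (Gs j) (hG j)
  have nn : ∀ H : SimpleGraph (Fin 3), 0 ≤ inducedDensity H (Gs j) := by
    intro H
    rw [inducedDensity_eq]
    positivity
  have n0 := nn ⊥
  have n1 := nn path3ᶜ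
  have n2 := nn path3
  have hcs := sq_sum_le_card_mul_sum_sq (s := (univ : Finset (Fin (m j))))
    (f := fun v => ((Gs j).degree v : ℝ))
  simp only [card_univ, Fintype.card_fin] at hcs
  have hn : (3 : ℝ) ≤ m j := by exact_mod_cast hj
  generalize inducedDensity path3ᶜ (Gs j) = x at *
  generalize inducedDensity path3 (Gs j) = y at *
  generalize inducedDensity (⊥ : SimpleGraph (Fin 3)) (Gs j) = z at *
  generalize (m j : ℝ) = n at *
  generalize ∑ v, ((Gs j).degree v : ℝ) = E at *
  generalize ∑ v, ((Gs j).degree v : ℝ) ^ 2 = Q at *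
  have hE : E = (x + 2 * y) * (n * (n - 1)) / 3 := by linarith
  have hQ : Q = y * (n * (n - 1) * (n - 2)) / 3 + (x + 2 * y) * (n * (n - 1)) / 3 := by linarith
  subst hE hQ
  have hpos : 0 < n ^ 2 * (n - 1) / 9 := by
    have : 0 < n - 1 := by linarith
    positivity
  have h4 : (x + 2 * y) ^ 2 * (n - 1) ≤ 3 * (n - 2) * y + 3 * (x + 2 * y) := by
    refine le_of_mul_le_mul_left ?_ hpos
    linarith
  have hn1 : 0 < n - 1 := by linarith
  have : (x + 2 * y) ^ 2 ≤ (3 * (n - 1) * y + 6) / (n - 1) := by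
    rw [le_div_iff₀ hn1]
    nlinarith
  refine this.trans (le_of_eq ?_)
  field_simp

/-- The biregular bipartite construction. -/
def cyc (N r k : ℕ) [NeZero N] : SimpleGraph (Fin N × Fin N) where
  Adj x y := ¬ (x.1.val < r ↔ y.1.val < r) ∧ (x.2 + y.2).val < k
  symm := ⟨by
    intro x y h
    rw [add_comm]
    exact ⟨fun h' => h.1 h'.symm, h.2⟩⟩
  loopless := ⟨fun x h => h.1 Iff.rfl⟩

lemma cyc_colorable (N r k : ℕ) [NeZero N] : (cyc N r k).Colorable 2 := by
  refine ⟨SimpleGraph.Coloring.mk (fun x => if x.1.val < r then 0 else 1) ?_⟩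
  intro x y h
  have := h.1
  split_ifs <;> simp_all

lemma card_lt (N r : ℕ) (hr : r ≤ N) :
    (univ.filter (fun i : Fin N => i.val < r)).card = r := by
  rw [Fin.card_filter_val_lt]
  omega

lemma cyc_degree (N r k : ℕ) [NeZero N] (hr : r ≤ N) (hk : k ≤ N) (x : Fin N × Fin N) :
    (cyc N r k).degree x = if x.1.val < r then (N - r) * k else r * k := by
  have h1 : (univ.filter (fun u : Fin N => (x.2 + u).val < k)).card = k := by
    refine Eq.trans ?_ (card_lt N k hk)
    refine Finset.card_bij (fun u _ => x.2 + u) ?_ ?_ ?_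
    · intro u hu
      simpa using hu
    · intro u _ u' _ h
      simpa using h
    · intro w hw
      refine ⟨w - x.2, ?_, by abel⟩
      simpa using hw
  have h2 : (univ.filter (fun i : Fin N => ¬ i.val < r)).card = N - r := by
    have := Finset.card_filter_add_card_filter_not (s := (univ : Finset (Fin N)))
      (fun i : Fin N => i.val < r)
    rw [card_lt N r hr, Finset.card_univ, Fintype.card_fin] at this
    omega
  have h3 : (cyc N r k).neighborFinset x =
      (univ.filter (fun i : Fin N => ¬ (x.1.val < r ↔ i.val < r))) ×ˢ
      (univ.filter (fun u : Fin N => (x.2 + u).val < k)) := by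
    ext y
    rw [SimpleGraph.mem_neighborFinset, mem_product, mem_filter, mem_filter]
    simp only [mem_univ, true_and]
    rfl
  rw [← SimpleGraph.card_neighborFinset_eq_degree, h3, Finset.card_product, h1]
  split_ifs with h
  · simp only [h, true_iff, h2]
  · simp only [h, false_iff, not_not, card_lt N r hr]

/-- transported to `Fin (N * N)` -/
def cycF (N r k : ℕ) [NeZero N] : SimpleGraph (Fin (N * N)) :=
  (cyc N r k).comap finProdFinEquiv.symm

lemma cycF_sum (N r k : ℕ) [NeZero N] (hr : r ≤ N) (hk : k ≤ N) (f : ℕ → ℝ) :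
    ∑ v, f ((cycF N r k).degree v) = N * (r * f ((N - r) * k) + (N - r) * f (r * k)) := by
  have e : cycF N r k ≃g cyc N r k := SimpleGraph.Iso.comap finProdFinEquiv.symm _
  have h1 : ∑ v, f ((cycF N r k).degree v) = ∑ x, f ((cyc N r k).degree x) := by
    refine Fintype.sum_equiv e.toEquiv _ _ ?_
    intro v
    congr 1
    exact (e.degree_eq v).symm
  rw [h1]
  simp_rw [cyc_degree N r k hr hk]
  rw [Fintype.sum_prod_type]
  have h0 : ∀ x : Fin N, ∑ _y : Fin N, f (if x.val < r then (N - r) * k else r * k)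
      = N * f (if x.val < r then (N - r) * k else r * k) := by
    intro x
    rw [Finset.sum_const, card_univ, Fintype.card_fin, nsmul_eq_mul]
  rw [Finset.sum_congr rfl (fun x _ => h0 x)]
  rw [← Finset.mul_sum]
  congr 1
  simp_rw [apply_ite f]
  rw [Finset.sum_ite, sum_const, sum_const, card_lt N r hr]
  have := Finset.card_filter_add_card_filter_not (s := (univ : Finset (Fin N)))
      (fun i : Fin N => i.val < r)
  rw [card_lt N r hr, Finset.card_univ, Fintype.card_fin] at this
  have h2 : (univ.filter (fun i : Fin N => ¬ i.val < r)).card = N - r := by omega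
  rw [h2, nsmul_eq_mul, nsmul_eq_mul, Nat.cast_sub hr]

lemma cycF_colorable (N r k : ℕ) [NeZero N] : (cycF N r k).Colorable 2 :=
  (cyc_colorable N r k).of_hom
    (SimpleGraph.Iso.comap finProdFinEquiv.symm (cyc N r k)).toHom

lemma bp_tf {n : ℕ} {G : SimpleGraph (Fin n)} (h : G.Colorable 2) : G.CliqueFree 3 :=
  h.cliqueFree (by norm_num)

lemma ineq_to_bp (p₀ p₁ p₂ : ℝ)
    (h₁ : 0 ≤ p₁) (h₂ : 0 ≤ p₂) (hsum : p₀ + p₁ + p₂ = 1)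
    (h : (p₁ + 2 * p₂) ^ 2 ≤ 3 * p₂) :
    memDeltaClass bipartiteClass (ms := fun _ => 3)
        ![(⊥ : SimpleGraph (Fin 3)), path3ᶜ, path3] ![p₀, p₁, p₂] := by
  obtain ⟨a, q, ha0, ha1, hq0, hq1, hp1, hp2⟩ : ∃ a q : ℝ, 0 ≤ a ∧ a ≤ 1 ∧ 0 ≤ q ∧ q ≤ 1 ∧
      p₁ + 2 * p₂ = 6 * (a * (1 - a) * q) ∧ p₂ = 3 * (a * (1 - a) * q ^ 2) := by
    rcases h₂.eq_or_lt with h' | h'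
    · subst h'
      refine ⟨0, 0, le_rfl, by norm_num, le_rfl, by norm_num, by nlinarith, by ring⟩
    · have hpos : 0 < p₁ + 2 * p₂ := by linarith
      have hc : (p₁ + 2 * p₂) ^ 2 / (12 * p₂) ≤ 1 / 4 := by
        rw [div_le_iff₀ (by positivity)]
        linarith
      have hc0 : 0 ≤ (p₁ + 2 * p₂) ^ 2 / (12 * p₂) := by positivity
      set c := (p₁ + 2 * p₂) ^ 2 / (12 * p₂) with hcdef
      have hs := Real.sq_sqrt (show 0 ≤ 1 - 4 * c by linarith)
      have hs0 := Real.sqrt_nonneg (1 - 4 * c)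
      have hs1 : Real.sqrt (1 - 4 * c) ≤ 1 := Real.sqrt_le_one.2 (by linarith)
      have hac : (1 - Real.sqrt (1 - 4 * c)) / 2 * (1 - (1 - Real.sqrt (1 - 4 * c)) / 2) = c := by
        nlinarith
      refine ⟨(1 - Real.sqrt (1 - 4 * c)) / 2, 2 * p₂ / (p₁ + 2 * p₂), by linarith, by linarith,
        by positivity, ?_, ?_, ?_⟩
      · rw [div_le_one hpos]; linarith
      · rw [hac, hcdef]; field_simp; ring
      · rw [hac, hcdef]; field_simp; ring
  let r : ℕ → ℕ := fun j => ⌊a * ((j + 1 : ℕ) : ℝ)⌋₊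
  let k : ℕ → ℕ := fun j => ⌊q * ((j + 1 : ℕ) : ℝ)⌋₊
  have hr : ∀ j, r j ≤ j + 1 := by
    intro j
    apply Nat.floor_le_of_le
    have : (0 : ℝ) ≤ ((j + 1 : ℕ) : ℝ) := by positivity
    nlinarith
  have hk : ∀ j, k j ≤ j + 1 := by
    intro j
    apply Nat.floor_le_of_le
    have : (0 : ℝ) ≤ ((j + 1 : ℕ) : ℝ) := by positivity
    nlinarith
  have hN : Filter.Tendsto (fun j : ℕ => ((j + 1 : ℕ) : ℝ)) Filter.atTop Filter.atTop :=
    tendsto_natCast_atTop_atTop.comp (Filter.tendsto_add_atTop_nat 1)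
  have hrl : Filter.Tendsto (fun j => (r j : ℝ) / ((j + 1 : ℕ) : ℝ)) Filter.atTop (nhds a) :=
    (tendsto_nat_floor_mul_div_atTop ha0).comp hN
  have hkl : Filter.Tendsto (fun j => (k j : ℝ) / ((j + 1 : ℕ) : ℝ)) Filter.atTop (nhds q) :=
    (tendsto_nat_floor_mul_div_atTop hq0).comp hN
  have hNi : Filter.Tendsto (fun j : ℕ => (((j + 1 : ℕ) : ℝ))⁻¹) Filter.atTop (nhds 0) :=
    tendsto_inv_atTop_zero.comp hN
  have hm : Filter.Tendsto (fun j : ℕ => (j + 1) * (j + 1)) Filter.atTop Filter.atTop := by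
    apply Filter.tendsto_atTop_mono (f := fun j : ℕ => j) _ Filter.tendsto_id
    intro j
    nlinarith
  have hcol : ∀ j, (cycF (j + 1) (r j) (k j)).Colorable 2 := fun j => cycF_colorable _ _ _
  have key : ∀ j, 2 ≤ j →
      inducedDensity (⊥ : SimpleGraph (Fin 3)) (cycF (j + 1) (r j) (k j)) +
        inducedDensity path3ᶜ (cycF (j + 1) (r j) (k j)) +
        inducedDensity path3 (cycF (j + 1) (r j) (k j)) = 1 ∧
      inducedDensity path3ᶜ (cycF (j + 1) (r j) (k j)) +
        2 * inducedDensity path3 (cycF (j + 1) (r j) (k j)) =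
        6 * ((r j : ℝ) / ((j + 1 : ℕ) : ℝ) * (1 - (r j : ℝ) / ((j + 1 : ℕ) : ℝ))
          * ((k j : ℝ) / ((j + 1 : ℕ) : ℝ))) / (1 - ((((j + 1 : ℕ) : ℝ))⁻¹) ^ 2) ∧
      inducedDensity path3 (cycF (j + 1) (r j) (k j)) =
        3 * ((r j : ℝ) / ((j + 1 : ℕ) : ℝ) * (1 - (r j : ℝ) / ((j + 1 : ℕ) : ℝ))
          * ((k j : ℝ) / ((j + 1 : ℕ) : ℝ)) ^ 2 -
          2 * ((r j : ℝ) / ((j + 1 : ℕ) : ℝ) * (1 - (r j : ℝ) / ((j + 1 : ℕ) : ℝ))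
          * ((k j : ℝ) / ((j + 1 : ℕ) : ℝ))) * ((((j + 1 : ℕ) : ℝ))⁻¹) ^ 2) /
          ((1 - ((((j + 1 : ℕ) : ℝ))⁻¹) ^ 2) * (1 - 2 * ((((j + 1 : ℕ) : ℝ))⁻¹) ^ 2)) := by
    intro j hj
    obtain ⟨d0, d1, d2⟩ := densities (n := (j + 1) * (j + 1)) (by nlinarith)
      (cycF (j + 1) (r j) (k j)) (bp_tf (hcol j))
    have s1 := cycF_sum (j + 1) (r j) (k j) (hr j) (hk j) (fun d => (d : ℝ))
    have s2 := cycF_sum (j + 1) (r j) (k j) (hr j) (hk j) (fun d => (d : ℝ) ^ 2)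
    simp only [Nat.cast_mul, Nat.cast_sub (hr j)] at s1 s2 d1 d2
    rw [s1] at d1
    rw [s1, s2] at d2
    refine ⟨d0, ?_, ?_⟩
    · have hn : (3 : ℝ) ≤ ((j + 1 : ℕ) : ℝ) := by exact_mod_cast (by omega)
      generalize ((j + 1 : ℕ) : ℝ) = n at *
      have e1 : n ^ 2 - 1 ≠ 0 := by nlinarith
      have e0 : n ≠ 0 := by linarith
      have f1 : 1 - (n⁻¹) ^ 2 ≠ 0 := by
        intro hh
        apply e1
        field_simp at hh
        linarith
      rw [eq_div_iff f1]
      field_simp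
      refine mul_left_cancel₀ e0 ?_
      linarith
    · have hn : (3 : ℝ) ≤ ((j + 1 : ℕ) : ℝ) := by exact_mod_cast (by omega)
      generalize ((j + 1 : ℕ) : ℝ) = n at *
      have e1 : n ^ 2 - 1 ≠ 0 := by nlinarith
      have e2 : n ^ 2 - 2 ≠ 0 := by nlinarith
      have e0 : n ≠ 0 := by linarith
      have f1 : 1 - (n⁻¹) ^ 2 ≠ 0 := by
        intro hh
        apply e1
        field_simp at hh
        linarith
      have f2 : 1 - 2 * (n⁻¹) ^ 2 ≠ 0 := by
        intro hh
        apply e2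
        field_simp at hh
        linarith
      rw [eq_div_iff (mul_ne_zero f1 f2)]
      field_simp
      refine mul_left_cancel₀ e0 ?_
      linarith
  have hA : Filter.Tendsto (fun j => (r j : ℝ) / ((j + 1 : ℕ) : ℝ) *
      (1 - (r j : ℝ) / ((j + 1 : ℕ) : ℝ))) Filter.atTop (nhds (a * (1 - a))) :=
    hrl.mul (hrl.const_sub 1)
  have hI2 : Filter.Tendsto (fun j : ℕ => ((((j + 1 : ℕ) : ℝ))⁻¹) ^ 2) Filter.atTop (nhds 0) := by
    simpa using hNi.pow 2
  have t12 : Filter.Tendsto (fun j => inducedDensity path3ᶜ (cycF (j + 1) (r j) (k j)) +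
        2 * inducedDensity path3 (cycF (j + 1) (r j) (k j))) Filter.atTop
        (nhds (p₁ + 2 * p₂)) := by
    have := ((hA.mul hkl).const_mul 6).div (hI2.const_sub 1) (by norm_num)
    rw [sub_zero, div_one, ← hp1] at this
    refine this.congr' ?_
    filter_upwards [Filter.eventually_ge_atTop 2] with j hj
    exact (key j hj).2.1.symm
  have t2 : Filter.Tendsto (fun j => inducedDensity path3 (cycF (j + 1) (r j) (k j))) Filter.atTop
        (nhds p₂) := by
    have := (((hA.mul (hkl.pow 2)).sub (((hA.mul hkl).const_mul 2).mul hI2)).const_mul 3).div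
      ((hI2.const_sub 1).mul ((hI2.const_mul 2).const_sub 1)) (by norm_num)
    simp only [mul_zero, sub_zero, mul_one, div_one] at this
    rw [← hp2] at this
    refine this.congr' ?_
    filter_upwards [Filter.eventually_ge_atTop 2] with j hj
    exact (key j hj).2.2.symm
  have t1 : Filter.Tendsto (fun j => inducedDensity path3ᶜ (cycF (j + 1) (r j) (k j))) Filter.atTop
        (nhds p₁) := by
    have := t12.sub (t2.const_mul 2)
    simpa using this
  have t0 : Filter.Tendsto (fun j => inducedDensity (⊥ : SimpleGraph (Fin 3))
      (cycF (j + 1) (r j) (k j))) Filter.atTop (nhds p₀) := by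
    have := (t1.add t2).const_sub 1
    rw [show 1 - (p₁ + p₂) = p₀ by linarith] at this
    refine this.congr' ?_
    filter_upwards [Filter.eventually_ge_atTop 2] with j hj
    have := (key j hj).1
    linarith
  refine ⟨fun j => (j + 1) * (j + 1), fun j => cycF (j + 1) (r j) (k j), hcol, hm, ?_⟩
  intro i
  fin_cases i
  · exact t0
  · exact t1
  · exact t2

/-- Characterization of 3-local profiles of triangle-free graphs: for `p₀,p₁,p₂ ≥ 0` with
`p₀+p₁+p₂ = 1`, membership in `Δ_TF(K̄₃,P̄₃,P₃)`, positive semidefiniteness of the flag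
matrix, and membership in `Δ_BP(K̄₃,P̄₃,P₃)` are all equivalent. -/
theorem triangle_free_profiles (p₀ p₁ p₂ : ℝ)
    (h₀ : 0 ≤ p₀) (h₁ : 0 ≤ p₁) (h₂ : 0 ≤ p₂) (hsum : p₀ + p₁ + p₂ = 1) :
    (memDeltaClass triangleFreeClass (ms := fun _ => 3)
        ![(⊥ : SimpleGraph (Fin 3)), path3ᶜ, path3] ![p₀, p₁, p₂] ↔
      (profileMatrix p₀ p₁ p₂).PosSemidef) ∧
    ((profileMatrix p₀ p₁ p₂).PosSemidef ↔
      memDeltaClass bipartiteClass (ms := fun _ => 3)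
        ![(⊥ : SimpleGraph (Fin 3)), path3ᶜ, path3] ![p₀, p₁, p₂]) := by
  have bt : memDeltaClass bipartiteClass (ms := fun _ => 3)
        ![(⊥ : SimpleGraph (Fin 3)), path3ᶜ, path3] ![p₀, p₁, p₂] →
      memDeltaClass triangleFreeClass (ms := fun _ => 3)
        ![(⊥ : SimpleGraph (Fin 3)), path3ᶜ, path3] ![p₀, p₁, p₂] := by
    rintro ⟨m, Gs, hG, hm, hl⟩
    exact ⟨m, Gs, fun j => bp_tf (hG j), hm, hl⟩
  rw [psd_iff p₀ p₁ p₂ h₀ h₁ h₂ hsum]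
  have f1 := tf_to_ineq p₀ p₁ p₂
  have f2 := ineq_to_bp p₀ p₁ p₂ h₁ h₂ hsum
  exact ⟨⟨f1, fun h => bt (f2 h)⟩, ⟨f2, fun h => f1 (bt h)⟩⟩
end

section
/- Let p_0, p_1, p_2 ≥ 0 with p_0 + p_1 + p_2 = 1, and suppose the 2×2 matrix p_0·[[1,0],[0,0]] + p_1·[[1/3,1/3],[1/3,0]] + p_2·[[0,1/3],[1/3,1/3]] is positive semidefinite. Then (p_0, p_1, p_2) ∈ Δ_BP(K̄_3, P̄_3, P_3); i.e., there exists a sequence of bipartite graphs G_n with |V(G_n)| → ∞ such that d(K̄_3; G_n) → p_0, d(P̄_3; G_n) → p_1 and d(P_3; G_n) → p_2. -/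
open Finset

open scoped Classical

lemma iso_iff_triple {V : Type*} [DecidableEq V] (H : SimpleGraph (Fin 3)) (G : SimpleGraph V)
    (S : Finset V) : Nonempty (H ≃g G.induce (S : Set V)) ↔
      ∃ a b c : V, a ≠ b ∧ a ≠ c ∧ b ≠ c ∧ S = {a, b, c} ∧
        (G.Adj a b ↔ H.Adj 0 1) ∧ (G.Adj a c ↔ H.Adj 0 2) ∧ (G.Adj b c ↔ H.Adj 1 2) := by
  constructor
  · rintro ⟨φ⟩
    have hinj : ∀ i j : Fin 3, i ≠ j → (φ i : V) ≠ φ j := by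
      intro i j hij h
      exact hij (φ.injective (Subtype.ext h))
    have hadj : ∀ i j : Fin 3, G.Adj (φ i : V) (φ j) ↔ H.Adj i j := by
      intro i j
      have := φ.map_adj_iff (v := i) (w := j)
      simpa using this
    refine ⟨φ 0, φ 1, φ 2, hinj _ _ (by decide), hinj _ _ (by decide), hinj _ _ (by decide), ?_,
      hadj _ _, hadj _ _, hadj _ _⟩
    ext x
    constructor
    · intro hx
      obtain ⟨i, hi⟩ := φ.surjective ⟨x, hx⟩
      have hx' : x = φ i := by rw [hi]
      fin_cases i <;> simp [hx']
    · intro hx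
      simp only [Finset.mem_insert, Finset.mem_singleton] at hx
      rcases hx with rfl | rfl | rfl <;> exact (φ _).2
  · rintro ⟨a, b, c, hab, hac, hbc, rfl, h1, h2, h3⟩
    have hm : ∀ i : Fin 3, (![a, b, c] i) ∈ ((({a, b, c} : Finset V)) : Set V) := by
      intro i; fin_cases i <;> simp
    let f : Fin 3 → ((({a, b, c} : Finset V)) : Set V) := fun i => ⟨![a, b, c] i, hm i⟩
    have hf : Function.Bijective f := by
      constructor
      · intro i j hij
        have h : ![a, b, c] i = ![a, b, c] j := congrArg Subtype.val hij
        fin_cases i <;> fin_cases j <;> simp_all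
      · rintro ⟨x, hx⟩
        have hx' := hx
        simp only [Finset.coe_insert, Finset.coe_singleton, Set.mem_insert_iff,
          Set.mem_singleton_iff] at hx'
        rcases hx' with rfl | rfl | rfl
        · exact ⟨0, rfl⟩
        · exact ⟨1, rfl⟩
        · exact ⟨2, rfl⟩
    refine ⟨⟨Equiv.ofBijective f hf, ?_⟩⟩
    intro i j
    change G.Adj (![a, b, c] i) (![a, b, c] j) ↔ H.Adj i j
    have h1' := h1
    have h2' := h2
    have h3' := h3
    rw [G.adj_comm, H.adj_comm] at h1' h2' h3'
    fin_cases i <;> fin_cases j <;> simp_all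

lemma path3_01 : path3.Adj 0 1 := by simp [path3]
lemma path3_02 : ¬ path3.Adj 0 2 := by simp [path3]
lemma path3_12 : path3.Adj 1 2 := by simp [path3]

lemma iso_path {V : Type*} [DecidableEq V] (G : SimpleGraph V) {x y z : V} (hxy : x ≠ y) (hxz : x ≠ z)
    (hyz : y ≠ z) : Nonempty (path3 ≃g G.induce ((({x, y, z} : Finset V)) : Set V)) ↔
      (G.Adj x y ∧ G.Adj y z ∧ ¬ G.Adj x z) ∨ (G.Adj x y ∧ ¬ G.Adj y z ∧ G.Adj x z) ∨
      (¬ G.Adj x y ∧ G.Adj y z ∧ G.Adj x z) := by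
  rw [iso_iff_triple]
  simp only [path3_01, path3_02, path3_12, iff_true, iff_false]
  constructor
  · rintro ⟨a, b, c, hab, hac, hbc, hS, h1, h2, h3⟩
    have ha : a = x ∨ a = y ∨ a = z := by
      have : a ∈ ({x, y, z} : Finset V) := by rw [hS]; simp
      simpa using this
    have hb : b = x ∨ b = y ∨ b = z := by
      have : b ∈ ({x, y, z} : Finset V) := by rw [hS]; simp
      simpa using this
    have hc : c = x ∨ c = y ∨ c = z := by
      have : c ∈ ({x, y, z} : Finset V) := by rw [hS]; simp
      simpa using this
    have h1' := h1.symm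
    have h3' := h3.symm
    have h2' : ¬ G.Adj c a := fun h => h2 h.symm
    clear hS
    rcases ha with rfl | rfl | rfl <;> rcases hb with rfl | rfl | rfl <;>
      rcases hc with rfl | rfl | rfl <;> first | (exfalso; tauto) | tauto
  · rintro (⟨h1, h2, h3⟩ | ⟨h1, h2, h3⟩ | ⟨h1, h2, h3⟩)
    · exact ⟨x, y, z, hxy, hxz, hyz, rfl, h1, h3, h2⟩
    · exact ⟨y, x, z, hxy.symm, hyz, hxz, by ext; simp; tauto, h1.symm, h2, h3⟩
    · exact ⟨x, z, y, hxz, hxy, hyz.symm, by ext; simp; tauto, h3, h1, h2.symm⟩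

lemma iso_copath {V : Type*} [DecidableEq V] (G : SimpleGraph V) {x y z : V} (hxy : x ≠ y) (hxz : x ≠ z)
    (hyz : y ≠ z) : Nonempty (path3ᶜ ≃g G.induce ((({x, y, z} : Finset V)) : Set V)) ↔
      (¬ G.Adj x y ∧ ¬ G.Adj y z ∧ G.Adj x z) ∨ (¬ G.Adj x y ∧ G.Adj y z ∧ ¬ G.Adj x z) ∨
      (G.Adj x y ∧ ¬ G.Adj y z ∧ ¬ G.Adj x z) := by
  have hc := iso_path Gᶜ hxy hxz hyz
  have hc2 : Nonempty (path3ᶜ ≃g G.induce ((({x, y, z} : Finset V)) : Set V)) ↔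
      Nonempty (path3 ≃g Gᶜ.induce ((({x, y, z} : Finset V)) : Set V)) := ?_
  · rw [hc2, hc]
    simp only [SimpleGraph.compl_adj, hxy, hxz, hyz, ne_eq, not_false_eq_true, true_and, not_not]
  rw [iso_iff_triple, iso_iff_triple]
  · refine exists_congr fun a => exists_congr fun b => exists_congr fun c => ?_
    simp only [SimpleGraph.compl_adj]
    have e1 : (0 : Fin 3) ≠ 1 := by decide
    have e2 : (0 : Fin 3) ≠ 2 := by decide
    have e3 : (1 : Fin 3) ≠ 2 := by decide
    constructor
    · rintro ⟨hab, hac, hbc, hS, k1, k2, k3⟩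
      exact ⟨hab, hac, hbc, hS, by simpa [hab, path3_01] using k1,
        by simpa [hac, path3_02] using k2, by simpa [hbc, path3_12] using k3⟩
    · rintro ⟨hab, hac, hbc, hS, k1, k2, k3⟩
      exact ⟨hab, hac, hbc, hS, by simpa [hab, path3_01] using k1,
        by simpa [hac, path3_02] using k2, by simpa [hbc, path3_12] using k3⟩

lemma iso_empty {V : Type*} [DecidableEq V] (G : SimpleGraph V) {x y z : V} (hxy : x ≠ y) (hxz : x ≠ z)
    (hyz : y ≠ z) :
    Nonempty ((⊥ : SimpleGraph (Fin 3)) ≃g G.induce ((({x, y, z} : Finset V)) : Set V)) ↔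
      (¬ G.Adj x y ∧ ¬ G.Adj y z ∧ ¬ G.Adj x z) := by
  rw [iso_iff_triple]
  simp only [SimpleGraph.bot_adj, iff_false]
  constructor
  · rintro ⟨a, b, c, hab, hac, hbc, hS, h1, h2, h3⟩
    have ha : ∀ t, t ∈ ({x, y, z} : Finset V) → t = a ∨ t = b ∨ t = c := by
      intro t ht
      rw [hS] at ht
      simpa using ht
    have hx := ha x (by simp)
    have hy := ha y (by simp)
    have hz := ha z (by simp)
    have h1' : ¬ G.Adj b a := fun h => h1 h.symm
    have h2' : ¬ G.Adj c a := fun h => h2 h.symm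
    have h3' : ¬ G.Adj c b := fun h => h3 h.symm
    clear hS ha
    rcases hx with rfl | rfl | rfl <;> rcases hy with rfl | rfl | rfl <;>
      rcases hz with rfl | rfl | rfl <;> first | (exfalso; tauto) | tauto
  · rintro ⟨h1, h2, h3⟩
    exact ⟨x, y, z, hxy, hxz, hyz, rfl, h1, h3, h2⟩

/-- Summing over 3-sets versus summing over ordered triples of distinct vertices. -/
lemma sum_triples {V : Type*} [Fintype V] [DecidableEq V] (f : Finset V → ℝ) :
    ∑ x : V, ∑ y : V, ∑ z : V, (if x ≠ y ∧ x ≠ z ∧ y ≠ z then f {x, y, z} else 0) =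
      6 * ∑ S ∈ (univ : Finset V).powersetCard 3, f S := by
  have h1 : ∑ x : V, ∑ y : V, ∑ z : V, (if x ≠ y ∧ x ≠ z ∧ y ≠ z then f {x, y, z} else 0) =
      ∑ t ∈ (univ : Finset (V × V × V)).filter
        (fun t => t.1 ≠ t.2.1 ∧ t.1 ≠ t.2.2 ∧ t.2.1 ≠ t.2.2), f {t.1, t.2.1, t.2.2} := by
    rw [Finset.sum_filter, Fintype.sum_prod_type]
    refine Finset.sum_congr rfl fun x _ => ?_
    rw [Fintype.sum_prod_type]
  rw [h1, ← Finset.sum_fiberwise_of_maps_to (t := (univ : Finset V).powersetCard 3)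
    (g := fun t : V × V × V => ({t.1, t.2.1, t.2.2} : Finset V)), Finset.mul_sum]
  · refine Finset.sum_congr rfl fun S hS => ?_
    rw [Finset.sum_congr rfl (g := fun _ => f S), Finset.sum_const]
    · obtain ⟨a, b, c, hab, hac, hbc, rfl⟩ := Finset.card_eq_three.1 (Finset.mem_powersetCard.1 hS).2
      have : (((univ : Finset (V × V × V)).filter
        (fun t => t.1 ≠ t.2.1 ∧ t.1 ≠ t.2.2 ∧ t.2.1 ≠ t.2.2)).filter
          (fun t : V × V × V => ({t.1, t.2.1, t.2.2} : Finset V) = {a, b, c})) =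
          {(a, b, c), (a, c, b), (b, a, c), (b, c, a), (c, a, b), (c, b, a)} := by
        ext ⟨x, y, z⟩
        simp only [Finset.mem_filter, Finset.mem_univ, true_and, Finset.mem_insert,
          Finset.mem_singleton, Prod.mk.injEq]
        constructor
        · rintro ⟨⟨hxy, hxz, hyz⟩, hS⟩
          have ha : ∀ t, t ∈ ({x, y, z} : Finset V) → t = a ∨ t = b ∨ t = c := by
            intro t ht
            rw [hS] at ht
            simpa using ht
          have hx := ha x (by simp)
          have hy := ha y (by simp)
          have hz := ha z (by simp)
          clear hS ha
          rcases hx with rfl | rfl | rfl <;> rcases hy with rfl | rfl | rfl <;>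
            rcases hz with rfl | rfl | rfl <;> first | (exfalso; tauto) | simp
        · rintro (⟨rfl, rfl, rfl⟩ | ⟨rfl, rfl, rfl⟩ | ⟨rfl, rfl, rfl⟩ | ⟨rfl, rfl, rfl⟩ |
            ⟨rfl, rfl, rfl⟩ | ⟨rfl, rfl, rfl⟩) <;>
          exact ⟨by tauto, by ext; simp; try tauto⟩
      rw [this]
      have h6 : ({(a, b, c), (a, c, b), (b, a, c), (b, c, a), (c, a, b), (c, b, a)} :
          Finset (V × V × V)).card = 6 := by
        repeat rw [Finset.card_insert_of_notMem (by simp [hab, hac, hbc, hab.symm, hac.symm, hbc.symm])]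
        simp
      rw [h6]; simp
    · intro t ht
      rw [(Finset.mem_filter.1 ht).2]
  · intro t ht
    have := (Finset.mem_filter.1 ht).2
    rw [Finset.mem_powersetCard]
    exact ⟨Finset.subset_univ _, Finset.card_eq_three.2 ⟨_, _, _, this.1, this.2.1, this.2.2, rfl⟩⟩

/-- number of 3-sets inducing `H` -/
noncomputable def cnt {V : Type*} [Fintype V] [DecidableEq V] (H : SimpleGraph (Fin 3))
    (G : SimpleGraph V) : ℝ :=
  ∑ S ∈ (univ : Finset V).powersetCard 3,
    if Nonempty (H ≃g G.induce (S : Set V)) then (1 : ℝ) else 0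

lemma density_eq {V : Type*} [Fintype V] [DecidableEq V] (H : SimpleGraph (Fin 3))
    (G : SimpleGraph V) :
    inducedDensity H G = cnt H G / ((univ : Finset V).powersetCard 3).card := by
  unfold inducedDensity cnt
  rw [Finset.card_filter, Nat.cast_sum]
  simp only [Nat.cast_ite, Nat.cast_one, Nat.cast_zero, Fintype.card_fin]
  congr 1
  have himg : (do
      let a ← (univ : Finset V).powersetCard 3
      pure (a : Set V)) = ((univ : Finset V).powersetCard 3).image (fun S : Finset V => (S : Set V)) := by
    simp
    rfl
  rw [himg, Finset.sum_image]
  intro S _ T _ h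
  exact Finset.coe_injective h

/-- degree as a real -/
noncomputable def dg {V : Type*} [Fintype V] (G : SimpleGraph V) (x : V) : ℝ :=
  ∑ y : V, if G.Adj x y then (1 : ℝ) else 0

section counting
variable {V : Type*} [Fintype V] [DecidableEq V] (G : SimpleGraph V)

lemma cnt_path (hT : ∀ x y z, G.Adj x y → G.Adj y z → ¬ G.Adj x z) :
    6 * cnt path3 G = 3 * (∑ x, dg G x ^ 2 - ∑ x, dg G x) := by
  let A : V → V → ℝ := fun x y => if G.Adj x y then 1 else 0
  have hs : ∀ x y, A x y = A y x := fun x y => by simp only [A, G.adj_comm]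
  let T : V → V → V → ℝ := fun x y z => A x y * A y z - (if x = z then A x y else 0)
  have hT1 : ∑ x, ∑ y, ∑ z, T x y z = ∑ x, dg G x ^ 2 - ∑ x, dg G x := by
    simp only [T, Finset.sum_sub_distrib]
    congr 1
    · rw [Finset.sum_comm]
      refine Finset.sum_congr rfl fun y _ => ?_
      rw [sq, dg, Finset.sum_mul_sum]
      refine Finset.sum_congr rfl fun x _ => Finset.sum_congr rfl fun z _ => ?_
      rw [hs x y]
    · simp [dg, A]
  have hT2 : ∑ x, ∑ y, ∑ z, T y x z = ∑ x, ∑ y, ∑ z, T x y z := Finset.sum_comm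
  have hT3 : ∑ x, ∑ y, ∑ z, T x z y = ∑ x, ∑ y, ∑ z, T x y z :=
    Finset.sum_congr rfl fun x _ => Finset.sum_comm
  have key : 6 * cnt path3 G = ∑ x, ∑ y, ∑ z, (T x y z + T y x z + T x z y) := by
    rw [cnt, ← sum_triples]
    refine Finset.sum_congr rfl fun x _ => Finset.sum_congr rfl fun y _ =>
      Finset.sum_congr rfl fun z _ => ?_
    have hsq : ∀ x y, A x y * A x y = A x y := fun x y => by simp only [A]; split_ifs <;> simp
    have h0 : ∀ x, A x x = 0 := fun x => by simp [A]
    by_cases hxy : x = y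
    · subst hxy; simp [T, h0, hs z x, hsq]
    by_cases hxz : x = z
    · subst hxz; simp [T, h0, hxy, Ne.symm hxy, hs y x, hsq]
    by_cases hyz : y = z
    · subst hyz; simp [T, h0, hxy, Ne.symm hxy, hs y x, hsq]
    rw [if_pos ⟨hxy, hxz, hyz⟩]
    simp only [iso_path G hxy hxz hyz, T, hxy, hxz, hyz, if_false, A, G.adj_comm y x, G.adj_comm z y]
    have := hT x y z
    by_cases h1 : G.Adj x y <;> by_cases h2 : G.Adj y z <;> by_cases h3 : G.Adj x z <;>
      simp_all
  rw [key]
  simp only [Finset.sum_add_distrib, hT2, hT3, hT1]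
  ring

lemma cnt_copath (hT : ∀ x y z, G.Adj x y → G.Adj y z → ¬ G.Adj x z) :
    6 * cnt path3ᶜ G + 2 * (6 * cnt path3 G) =
      3 * ((∑ x, dg G x) * ((Fintype.card V : ℝ) - 2)) := by
  let A : V → V → ℝ := fun x y => if G.Adj x y then 1 else 0
  have hs : ∀ x y, A x y = A y x := fun x y => by simp only [A, G.adj_comm]
  let T : V → V → V → ℝ := fun x y z =>
    A x y - (if x = z then A x y else 0) - (if y = z then A x y else 0)
  have hT1 : ∑ x, ∑ y, ∑ z, T x y z = (∑ x, dg G x) * ((Fintype.card V : ℝ) - 2) := by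
    rw [Finset.sum_mul]
    refine Finset.sum_congr rfl fun x _ => ?_
    rw [dg, Finset.sum_mul]
    refine Finset.sum_congr rfl fun y _ => ?_
    simp only [T, Finset.sum_sub_distrib, Finset.sum_ite_eq, Finset.mem_univ, if_true,
      Finset.sum_const, Finset.card_univ, nsmul_eq_mul]
    change _ = A x y * _
    ring
  have hT2 : ∑ x, ∑ y, ∑ z, T x z y = ∑ x, ∑ y, ∑ z, T x y z :=
    Finset.sum_congr rfl fun x _ => Finset.sum_comm
  have hT3 : ∑ x, ∑ y, ∑ z, T y z x = ∑ x, ∑ y, ∑ z, T x y z := by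
    rw [Finset.sum_comm]
    exact Finset.sum_congr rfl fun x _ => Finset.sum_comm
  have key : 6 * cnt path3ᶜ G + 2 * (6 * cnt path3 G) =
      ∑ x, ∑ y, ∑ z, (T x y z + T x z y + T y z x) := by
    rw [cnt, cnt, ← sum_triples, ← sum_triples]
    simp only [Finset.mul_sum, ← Finset.sum_add_distrib]
    refine Finset.sum_congr rfl fun x _ => Finset.sum_congr rfl fun y _ =>
      Finset.sum_congr rfl fun z _ => ?_
    have h0 : ∀ x, A x x = 0 := fun x => by simp [A]
    by_cases hxy : x = y
    · subst hxy
      by_cases h : x = z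
      · subst h; simp [T, h0]
      · simp [T, h0, h, Ne.symm h]
    by_cases hxz : x = z
    · subst hxz; simp [T, h0, hxy, Ne.symm hxy, hs y x]
    by_cases hyz : y = z
    · subst hyz; simp [T, h0, hxy, Ne.symm hxy, hs y x]
    have hd : x ≠ y ∧ x ≠ z ∧ y ≠ z := ⟨hxy, hxz, hyz⟩
    rw [if_pos hd, if_pos hd]
    simp only [iso_path G hxy hxz hyz, iso_copath G hxy hxz hyz, T, hxy, hxz, hyz, if_false, A,
      Ne.symm hxy, Ne.symm hxz, Ne.symm hyz]
    have := hT x y z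
    by_cases h1 : G.Adj x y <;> by_cases h2 : G.Adj y z <;> by_cases h3 : G.Adj x z <;>
      simp_all
    all_goals norm_num
  rw [key]
  simp only [Finset.sum_add_distrib, hT2, hT3, hT1]
  ring

lemma cnt_all (hT : ∀ x y z, G.Adj x y → G.Adj y z → ¬ G.Adj x z) :
    cnt ⊥ G + cnt path3ᶜ G + cnt path3 G = ((univ : Finset V).powersetCard 3).card := by
  rw [cnt, cnt, cnt, ← Finset.sum_add_distrib, ← Finset.sum_add_distrib, Finset.card_eq_sum_ones]
  push_cast
  refine Finset.sum_congr rfl fun S hS => ?_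
  obtain ⟨x, y, z, hxy, hxz, hyz, rfl⟩ := Finset.card_eq_three.1 (Finset.mem_powersetCard.1 hS).2
  simp only [iso_path G hxy hxz hyz, iso_copath G hxy hxz hyz, iso_empty G hxy hxz hyz]
  have := hT x y z
  by_cases h1 : G.Adj x y <;> by_cases h2 : G.Adj y z <;> by_cases h3 : G.Adj x z <;>
    simp_all

lemma card3 : 6 * (((univ : Finset V).powersetCard 3).card : ℝ) =
    (Fintype.card V : ℝ) * ((Fintype.card V : ℝ) - 1) * ((Fintype.card V : ℝ) - 2) := by
  rw [Finset.card_powersetCard, Finset.card_univ]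
  generalize Fintype.card V = n
  have h := Nat.descFactorial_eq_factorial_mul_choose n 3
  have h2 : (6 : ℝ) * (n.choose 3 : ℝ) = (n.descFactorial 3 : ℝ) := by
    rw [h]; push_cast; norm_num [Nat.factorial]
  rw [h2]
  rcases n with _ | _ | n
  · simp
  · simp [Nat.descFactorial]
  · simp [Nat.descFactorial]; ring

end counting

open Filter Topology in
/-- limits of densities are determined by the degree moments -/
lemma limits {m : ℕ → ℕ} (Gs : ∀ j, SimpleGraph (Fin (m j)))
    (hT : ∀ j x y z, (Gs j).Adj x y → (Gs j).Adj y z → ¬ (Gs j).Adj x z)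
    (hm : Tendsto m atTop atTop) {a b : ℝ}
    (ha : Tendsto (fun j => (∑ x, dg (Gs j) x) / (m j : ℝ) ^ 2) atTop (𝓝 a))
    (hb : Tendsto (fun j => (∑ x, dg (Gs j) x ^ 2) / (m j : ℝ) ^ 3) atTop (𝓝 b)) :
    Tendsto (fun j => inducedDensity (⊥ : SimpleGraph (Fin 3)) (Gs j)) atTop (𝓝 (1 - 3 * a + 3 * b)) ∧
    Tendsto (fun j => inducedDensity path3ᶜ (Gs j)) atTop (𝓝 (3 * a - 6 * b)) ∧
    Tendsto (fun j => inducedDensity path3 (Gs j)) atTop (𝓝 (3 * b)) := by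
  have hinv : Tendsto (fun j => ((m j : ℝ))⁻¹) atTop (𝓝 0) :=
    tendsto_inv_atTop_zero.comp (tendsto_natCast_atTop_atTop.comp hm)
  have hbig : ∀ᶠ j in atTop, 3 ≤ m j := hm.eventually_ge_atTop 3
  have hden : Tendsto (fun j => (1 - ((m j : ℝ))⁻¹) * (1 - 2 * ((m j : ℝ))⁻¹)) atTop (𝓝 1) := by
    have := (hinv.const_sub 1).mul ((hinv.const_mul 2).const_sub 1)
    simpa using this
  have h2 : Tendsto (fun j => inducedDensity path3 (Gs j)) atTop (𝓝 (3 * b)) := by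
    have h := ((hb.sub (ha.mul hinv)).const_mul 3).div hden one_ne_zero
    simp only [mul_zero, sub_zero, div_one] at h
    refine h.congr' ?_
    filter_upwards [hbig] with j hj
    have hj' : (3 : ℝ) ≤ m j := by exact_mod_cast hj
    have e1 := cnt_path (Gs j) (hT j)
    have e2 := card3 (V := Fin (m j))
    rw [Fintype.card_fin] at e2
    have n1 : (m j : ℝ) - 1 ≠ 0 := by linarith
    have n2 : (m j : ℝ) - 2 ≠ 0 := by linarith
    have n0 : (m j : ℝ) ≠ 0 := by linarith
    rw [density_eq, ← mul_div_mul_left _ _ (by norm_num : (6 : ℝ) ≠ 0), e1, e2]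
    simp only [Pi.div_apply]
    have d1 : 1 - (m j : ℝ)⁻¹ = ((m j : ℝ) - 1) / m j := by field_simp
    have d2 : 1 - 2 * (m j : ℝ)⁻¹ = ((m j : ℝ) - 2) / m j := by field_simp
    rw [d1, d2]
    field_simp
  have h1 : Tendsto (fun j => inducedDensity path3ᶜ (Gs j)) atTop (𝓝 (3 * a - 6 * b)) := by
    have h := (((ha.const_mul 3).div (hinv.const_sub 1) (by norm_num))).sub (h2.const_mul 2)
    have e : 3 * a / (1 - 0) - 2 * (3 * b) = 3 * a - 6 * b := by ring
    rw [e] at h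
    refine h.congr' ?_
    filter_upwards [hbig] with j hj
    have hj' : (3 : ℝ) ≤ m j := by exact_mod_cast hj
    have e1 := cnt_copath (Gs j) (hT j)
    have e2 := card3 (V := Fin (m j))
    rw [Fintype.card_fin] at e1 e2
    have n1 : (m j : ℝ) - 1 ≠ 0 := by linarith
    have n2 : (m j : ℝ) - 2 ≠ 0 := by linarith
    have n0 : (m j : ℝ) ≠ 0 := by linarith
    rw [density_eq, density_eq, ← mul_div_mul_left _ _ (by norm_num : (6 : ℝ) ≠ 0),
      ← mul_div_mul_left (cnt path3ᶜ _) _ (by norm_num : (6 : ℝ) ≠ 0), eq_sub_of_add_eq e1, e2]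
    simp only [Pi.div_apply]
    have d1 : 1 - (m j : ℝ)⁻¹ = ((m j : ℝ) - 1) / m j := by field_simp
    rw [d1]
    field_simp
  refine ⟨?_, h1, h2⟩
  have h := (h1.const_sub 1).sub h2
  have e : 1 - (3 * a - 6 * b) - 3 * b = 1 - 3 * a + 3 * b := by ring
  rw [e] at h
  refine h.congr' ?_
  filter_upwards [hbig] with j hj
  have hj' : (3 : ℝ) ≤ m j := by exact_mod_cast hj
  have e1 := cnt_all (Gs j) (hT j)
  have hpos : (((univ : Finset (Fin (m j))).powersetCard 3).card : ℝ) ≠ 0 := by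
    rw [Finset.card_powersetCard, Finset.card_univ, Fintype.card_fin]
    exact_mod_cast (Nat.choose_pos hj).ne'
  rw [density_eq, density_eq, density_eq]
  field_simp
  rw [← e1]; ring

/-- The biregular bipartite graph. -/
def bg (n u s : ℕ) : SimpleGraph (Fin (n + 1) × Fin (n + 1)) where
  Adj v w := ¬ (v.1.val < u ↔ w.1.val < u) ∧ (v.2 + w.2).val < s
  symm := ⟨by
    intro v w h
    exact ⟨fun h' => h.1 h'.symm, by rw [add_comm w.2 v.2]; exact h.2⟩⟩
  loopless := ⟨fun v h => h.1 Iff.rfl⟩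

lemma card_lt_s15 {n u : ℕ} (hu : u ≤ n + 1) :
    ∑ x : Fin (n + 1), (if x.val < u then (1 : ℝ) else 0) = u := by
  rw [Fin.sum_univ_eq_sum_range (fun i => if i < u then (1 : ℝ) else 0), ← Finset.sum_filter]
  have : (Finset.range (n + 1)).filter (fun i => i < u) = Finset.range u := by
    ext i; simp; omega
  rw [this]; simp

lemma card_ge {n u : ℕ} (hu : u ≤ n + 1) :
    ∑ x : Fin (n + 1), (if x.val < u then (0 : ℝ) else 1) = (n + 1 : ℝ) - u := by
  have : ∀ x : Fin (n + 1), (if x.val < u then (0 : ℝ) else 1) =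
      1 - (if x.val < u then (1 : ℝ) else 0) := by
    intro x; split_ifs <;> norm_num
  simp only [this, Finset.sum_sub_distrib, card_lt_s15 hu]
  simp

lemma dg_bg {n u s : ℕ} (hu : u ≤ n + 1) (hs : s ≤ n + 1) (v : Fin (n + 1) × Fin (n + 1)) :
    dg (bg n u s) v = (if v.1.val < u then (n + 1 : ℝ) - u else u) * s := by
  have e : ∀ x y : Fin (n + 1), (if (bg n u s).Adj v (x, y) then (1 : ℝ) else 0) =
      (if (v.1.val < u ↔ x.val < u) then (0 : ℝ) else 1) *
        (if (v.2 + y).val < s then (1 : ℝ) else 0) := by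
    intro x y
    have hadj : (bg n u s).Adj v (x, y) ↔ ¬ (v.1.val < u ↔ x.val < u) ∧ (v.2 + y).val < s := Iff.rfl
    rw [hadj]
    by_cases h1 : (v.1.val < u ↔ x.val < u) <;> by_cases h2 : (v.2 + y).val < s <;> simp [h1, h2]
  have h2 : ∑ y : Fin (n + 1), (if (v.2 + y).val < s then (1 : ℝ) else 0) = s := by
    rw [← card_lt_s15 hs]
    exact Equiv.sum_comp (Equiv.addLeft v.2) (fun y : Fin (n + 1) => if y.val < s then (1 : ℝ) else 0)
  rw [dg, Fintype.sum_prod_type]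
  simp only [e, ← Finset.mul_sum, h2, ← Finset.sum_mul]
  congr 1
  split_ifs with h
  · simp only [h, true_iff, card_ge hu]
  · simp only [h, false_iff, ite_not, card_lt_s15 hu]

lemma sum_dg_bg {n u s : ℕ} (hu : u ≤ n + 1) (hs : s ≤ n + 1) :
    ∑ v, dg (bg n u s) v = 2 * u * ((n + 1 : ℝ) - u) * (n + 1) * s := by
  simp only [dg_bg hu hs]
  rw [Fintype.sum_prod_type]
  have e : ∀ x : Fin (n + 1), (if x.val < u then (n + 1 : ℝ) - u else u) * s =
      ((n + 1 : ℝ) - u) * s * (if x.val < u then (1 : ℝ) else 0) +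
        u * s * (if x.val < u then (0 : ℝ) else 1) := by
    intro x; split_ifs <;> ring
  simp only [e, Finset.sum_const, nsmul_eq_mul, ← Finset.mul_sum, Finset.sum_add_distrib, card_ge hu,
    card_lt_s15 hu, Finset.card_univ, Fintype.card_fin]
  push_cast; ring

lemma sum_dg_sq_bg {n u s : ℕ} (hu : u ≤ n + 1) (hs : s ≤ n + 1) :
    ∑ v, dg (bg n u s) v ^ 2 = u * ((n + 1 : ℝ) - u) * (n + 1) ^ 2 * s ^ 2 := by
  simp only [dg_bg hu hs]
  rw [Fintype.sum_prod_type]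
  have e : ∀ x : Fin (n + 1), ((if x.val < u then (n + 1 : ℝ) - u else u) * s) ^ 2 =
      (((n + 1 : ℝ) - u) * s) ^ 2 * (if x.val < u then (1 : ℝ) else 0) +
        (u * s) ^ 2 * (if x.val < u then (0 : ℝ) else 1) := by
    intro x; split_ifs <;> ring
  simp only [e, Finset.sum_const, nsmul_eq_mul, ← Finset.mul_sum, Finset.sum_add_distrib, card_ge hu,
    card_lt_s15 hu, Finset.card_univ, Fintype.card_fin]
  push_cast; ring

lemma dg_comap {V W : Type*} [Fintype V] [Fintype W] (e : V ≃ W) (G : SimpleGraph W) (x : V) :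
    dg (G.comap e) x = dg G (e x) := by
  unfold dg
  exact Equiv.sum_comp e (fun y => if G.Adj (e x) y then (1 : ℝ) else 0)

lemma params {a b : ℝ} (ha : 0 ≤ a) (hb : a ^ 2 ≤ b) (hb' : 2 * b ≤ a) :
    ∃ α q : ℝ, 0 ≤ α ∧ α ≤ 1 ∧ 0 ≤ q ∧ q ≤ 1 ∧ 2 * α * (1 - α) * q = a ∧
      α * (1 - α) * q ^ 2 = b := by
  rcases ha.eq_or_lt with rfl | ha
  · exact ⟨0, 0, by norm_num, by norm_num, by norm_num, by norm_num, by norm_num, by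
      nlinarith⟩
  have hbpos : 0 < b := lt_of_lt_of_le (by positivity) hb
  have ht0 : 0 ≤ a ^ 2 / b := by positivity
  have ht : a ^ 2 / b ≤ 1 := by rw [div_le_one hbpos]; exact hb
  have hsq := Real.sq_sqrt (show 0 ≤ 1 - a ^ 2 / b by linarith)
  have hs0 := Real.sqrt_nonneg (1 - a ^ 2 / b)
  have hs1 : Real.sqrt (1 - a ^ 2 / b) ≤ 1 := by
    rw [Real.sqrt_le_one]; linarith
  set r := Real.sqrt (1 - a ^ 2 / b)
  have hα : (1 - r) / 2 * (1 - (1 - r) / 2) = a ^ 2 / (4 * b) := by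
    have : (1 - r) / 2 * (1 - (1 - r) / 2) = (1 - r ^ 2) / 4 := by ring
    rw [this, hsq]; field_simp; ring
  refine ⟨(1 - r) / 2, 2 * b / a, by linarith, by linarith, by positivity, ?_, ?_, ?_⟩
  · rw [div_le_one ha]; exact hb'
  · rw [mul_assoc 2, hα]; field_simp; try ring
  · rw [hα]; field_simp; try ring

open Filter Topology in
/-- If `p₀,p₁,p₂ ≥ 0` sum to `1` and the matrix
`p₀·[[1,0],[0,0]] + p₁·[[1/3,1/3],[1/3,0]] + p₂·[[0,1/3],[1/3,1/3]]` is positive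
semidefinite, then `(p₀,p₁,p₂) ∈ Δ_BP(K̄₃,P̄₃,P₃)`: there is a sequence of bipartite
graphs `G_n` with `|V(G_n)| → ∞`, `d(K̄₃;G_n) → p₀`, `d(P̄₃;G_n) → p₁`, `d(P₃;G_n) → p₂`. -/
theorem psd_profile_realizable_bipartite (p₀ p₁ p₂ : ℝ)
    (h₀ : 0 ≤ p₀) (h₁ : 0 ≤ p₁) (h₂ : 0 ≤ p₂) (hsum : p₀ + p₁ + p₂ = 1)
    (hpsd : (profileMatrix p₀ p₁ p₂).PosSemidef) :
    memDeltaClass bipartiteClass (ms := fun _ => 3)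
      ![(⊥ : SimpleGraph (Fin 3)), path3ᶜ, path3] ![p₀, p₁, p₂] := by
  have hdet := hpsd.det_nonneg
  rw [Matrix.det_fin_two] at hdet
  simp [profileMatrix] at hdet
  obtain ⟨α, q, hα0, hα1, hq0, hq1, ea, eb⟩ := params (a := (p₁ + 2 * p₂) / 3) (b := p₂ / 3)
    (by positivity) (by
      have : p₀ = 1 - p₁ - p₂ := by linarith
      subst this
      nlinarith) (by linarith)
  let u : ℕ → ℕ := fun n => ⌊α * ((n + 1 : ℕ) : ℝ)⌋₊
  let s : ℕ → ℕ := fun n => ⌊q * ((n + 1 : ℕ) : ℝ)⌋₊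
  have hu : ∀ n, u n ≤ n + 1 := fun n => Nat.floor_le_of_le (by
    have : (0 : ℝ) ≤ ((n + 1 : ℕ) : ℝ) := by positivity
    nlinarith)
  have hs : ∀ n, s n ≤ n + 1 := fun n => Nat.floor_le_of_le (by
    have : (0 : ℝ) ≤ ((n + 1 : ℕ) : ℝ) := by positivity
    nlinarith)
  have hcast : Tendsto (fun n : ℕ => ((n + 1 : ℕ) : ℝ)) atTop atTop :=
    tendsto_natCast_atTop_atTop.comp (tendsto_add_atTop_nat 1)
  have hul : Tendsto (fun n => (u n : ℝ) / ((n : ℝ) + 1)) atTop (𝓝 α) := by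
    have := (tendsto_nat_floor_mul_div_atTop hα0).comp hcast
    simpa [Function.comp_def, u] using this
  have hsl : Tendsto (fun n => (s n : ℝ) / ((n : ℝ) + 1)) atTop (𝓝 q) := by
    have := (tendsto_nat_floor_mul_div_atTop hq0).comp hcast
    simpa [Function.comp_def, s] using this
  let Gs : ∀ n, SimpleGraph (Fin ((n + 1) * (n + 1))) := fun n =>
    (bg n (u n) (s n)).comap (finProdFinEquiv (m := n + 1) (n := n + 1)).symm
  have hm : Tendsto (fun n : ℕ => (n + 1) * (n + 1)) atTop atTop :=
    tendsto_atTop_mono (fun n => by simp only [id]; nlinarith) tendsto_id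
  have hT : ∀ j x y z, (Gs j).Adj x y → (Gs j).Adj y z → ¬ (Gs j).Adj x z := by
    intro j x y z h1 h2 h3
    have h1' := h1.1
    have h2' := h2.1
    have h3' := h3.1
    tauto
  have hA : Tendsto (fun j => (∑ x, dg (Gs j) x) / (((j + 1) * (j + 1) : ℕ) : ℝ) ^ 2) atTop
      (𝓝 ((p₁ + 2 * p₂) / 3)) := by
    have h := ((hul.const_mul 2).mul (hul.const_sub 1)).mul hsl
    rw [ea] at h
    refine h.congr fun j => ?_
    simp only [Gs, dg_comap]
    rw [Equiv.sum_comp (finProdFinEquiv (m := j + 1) (n := j + 1)).symm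
      (fun v => dg (bg j (u j) (s j)) v), sum_dg_bg (hu j) (hs j)]
    have : (j : ℝ) + 1 ≠ 0 := by positivity
    push_cast
    field_simp
  have hB : Tendsto (fun j => (∑ x, dg (Gs j) x ^ 2) / (((j + 1) * (j + 1) : ℕ) : ℝ) ^ 3) atTop
      (𝓝 (p₂ / 3)) := by
    have h := (hul.mul (hul.const_sub 1)).mul (hsl.pow 2)
    rw [eb] at h
    refine h.congr fun j => ?_
    simp only [Gs, dg_comap]
    rw [Equiv.sum_comp (finProdFinEquiv (m := j + 1) (n := j + 1)).symm
      (fun v => dg (bg j (u j) (s j)) v ^ 2), sum_dg_sq_bg (hu j) (hs j)]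
    have : (j : ℝ) + 1 ≠ 0 := by positivity
    push_cast
    field_simp
  obtain ⟨l0, l1, l2⟩ := limits Gs hT hm hA hB
  refine ⟨fun n => (n + 1) * (n + 1), Gs, ?_, hm, ?_⟩
  · intro j
    refine ⟨SimpleGraph.Coloring.mk
      (fun x => if ((finProdFinEquiv (m := j + 1) (n := j + 1)).symm x).1.val < u j
        then (0 : Fin 2) else 1) ?_⟩
    intro v w h
    have h' := h.1
    split_ifs <;> first | (exfalso; tauto) | decide
  · intro i
    fin_cases i
    · have e : 1 - 3 * ((p₁ + 2 * p₂) / 3) + 3 * (p₂ / 3) = p₀ := by linarith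
      rw [e] at l0
      exact l0
    · have e : 3 * ((p₁ + 2 * p₂) / 3) - 6 * (p₂ / 3) = p₁ := by linarith
      rw [e] at l1
      exact l1
    · have e : 3 * (p₂ / 3) = p₂ := by linarith
      rw [e] at l2
      exact l2
end
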